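/- Let L(λ) := M_{τ_1}(Y_1) M_{σ_1}(X_1) (λ M_τ^P − M_σ^P) M_{σ_2}(X_2) M_{τ_2}(Y_2) be an EGFP of P(λ), and suppose 0 ∈ ω (where τ = −ω). Then: (a) if i_0(ω)+1 ∈ σ and s := i_0(ω) + c_{i_0(ω)+1}(σ) + 1 < m, then (e^T_{m−s} ⊗ I_n) M_{σ_2}(X_2) M_{τ_2}(Y_2) = e^T_{m−p} ⊗ I_n, where p := i_0(ω) + c_{i_0(ω)+1}(σ,σ_2) + 1; (b) if i_0(ω)+1 ∈ σ and i_0(ω) + c_{i_0(ω)+1}(σ) + 1 = m, then (e^T_1 ⊗ I_n) M_{σ_2}(X_2) M_{τ_2}(Y_2) = e^T_p ⊗ I_n, where p := c_{−(m−1)}(τ_2) + 2; (c) if i_0(ω) < m and i_0(ω)+1 ∉ σ, then (e^T_{m−i_0(ω)} ⊗ I_n) M_{σ_2}(X_2) M_{τ_2}(Y_2) = e^T_{m−p} ⊗ I_n, where p := i_0(ω) − c_{−i_0(ω)}(τ_2) − 1; (d) if i_0(ω) = m, then (e^T_m ⊗ I_n) M_{σ_2}(X_2) M_{τ_2}(Y_2)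 = e^T_m ⊗ I_n. -/

import Mathlib

open Matrix Polynomial

/-- Signed indices: `pos k` denotes `k` and `neg k` denotes `−k`, with `−0` and `0` distinct. -/
inductive SIdx : Type where
  | pos : ℕ → SIdx
  | neg : ℕ → SIdx
deriving DecidableEq

namespace SIdx

/-- The absolute value of a signed index. -/
def val : SIdx → ℕ
  | pos k => k
  | neg k => k

/-- Whether a signed index is negative. -/
def isNeg : SIdx → Bool
  | pos _ => false
  | neg _ => true

/-- The successor `t + 1` of a signed index (`−s + 1 = −(s−1)`). -/
def succ : SIdx → SIdx
  | pos k => pos (k + 1)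
  | neg 0 => pos 0
  | neg (k + 1) => neg k

/-- Negation of a signed index. -/
def negate : SIdx → SIdx
  | pos k => neg k
  | neg k => pos k

end SIdx

/-- The ascending chain `(t, t+1, …, t+p)`. -/
def chainUp (t : SIdx) : ℕ → List SIdx
  | 0 => [t]
  | p + 1 => t :: chainUp t.succ p

/-- The number of consecutions `c_t(α)` of the index tuple `α` at `t` (`−1` when `t ∉ α`):
the largest `p` such that `(t, t+1, …, t+p)` is a subtuple (sublist) of `α`. -/
noncomputable def consAt (α : List SIdx) (t : SIdx) : ℤ :=
  letI := Classical.decPred (fun p : ℕ => (chainUp t p).Sublist α)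
  if t ∈ α then (Nat.findGreatest (fun p : ℕ => (chainUp t p).Sublist α) α.length : ℤ) else -1

/-- The number of inversions `i_t(α)` of the index tuple `α` at `t` (`−1` when `t ∉ α`):
the largest `q` such that `(t+q, …, t+1, t)` is a subtuple (sublist) of `α`. -/
noncomputable def invsAt (α : List SIdx) (t : SIdx) : ℤ :=
  letI := Classical.decPred (fun p : ℕ => ((chainUp t p).reverse).Sublist α)
  if t ∈ α then (Nat.findGreatest (fun p : ℕ => ((chainUp t p).reverse).Sublist α) α.length : ℤ)
  else -1

/-- The Successor Infix Property: between any two equal entries there is an occurrence of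
their successor. -/
def SIP (α : List SIdx) : Prop :=
  ∀ a b : Fin α.length, a < b → α.get a = α.get b →
    ∃ c : Fin α.length, a < c ∧ c < b ∧ α.get c = (α.get a).succ

/-- The `mn × mn` elementary matrix `M_k(X)` (viewed as an `m × m` block matrix with
`n × n` blocks): `M_0(X) = M_{−0}(X) = diag(I_{(m−1)n}, X)`,
`M_m(X) = M_{−m}(X) = diag(X, I_{(m−1)n})`, and for `1 ≤ i ≤ m−1` the matrix `M_i(X)`
(resp. `M_{−i}(X)`) is the identity except for the 2×2 block submatrix
`[[X, I],[I, 0]]` (resp. `[[0, I],[I, X]]`) in block rows/columns `(m−i, m−i+1)`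
(1-indexed). -/
noncomputable def elemMat (m n : ℕ) (k : SIdx) (X : Matrix (Fin n) (Fin n) ℂ) :
    Matrix (Fin m × Fin n) (Fin m × Fin n) ℂ := fun p q =>
  if k.val = 0 then
    if p.1 = q.1 then (if (p.1 : ℕ) = m - 1 then X p.2 q.2 else if p.2 = q.2 then 1 else 0)
    else 0
  else if k.val = m then
    if p.1 = q.1 then (if (p.1 : ℕ) = 0 then X p.2 q.2 else if p.2 = q.2 then 1 else 0)
    else 0
  else
    if (p.1 : ℕ) = m - k.val - 1 ∧ (q.1 : ℕ) = m - k.val - 1 then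
      (if k.isNeg then 0 else X p.2 q.2)
    else if ((p.1 : ℕ) = m - k.val - 1 ∧ (q.1 : ℕ) = m - k.val) ∨
        ((p.1 : ℕ) = m - k.val ∧ (q.1 : ℕ) = m - k.val - 1) then
      (if p.2 = q.2 then 1 else 0)
    else if (p.1 : ℕ) = m - k.val ∧ (q.1 : ℕ) = m - k.val then
      (if k.isNeg then X p.2 q.2 else 0)
    else if p = q then 1 else 0

/-- `M_t(X) = M_{t_1}(X_1) ⋯ M_{t_r}(X_r)` for an index tuple `t` with matrix assignment `Xs`. -/
noncomputable def prodAssign (m n : ℕ) (t : List SIdx) (Xs : List (Matrix (Fin n) (Fin n) ℂ)) :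
    Matrix (Fin m × Fin n) (Fin m × Fin n) ℂ :=
  ((t.zip Xs).map fun p => elemMat m n p.1 p.2).prod

/-- The trivial (Fiedler) matrix assignment of `P(λ) = Σ λ^i A_i`:
`M_i^P = M_i(−A_i)` for `0 ≤ i ≤ m−1`, `M_m^P = (M_{−m}^P)⁻¹ = M_m(A_m⁻¹)`,
`M_{−i}^P = M_{−i}(A_i)` for `1 ≤ i ≤ m`, and `M_{−0}^P = (M_0^P)⁻¹ = M_{−0}((−A_0)⁻¹)`. -/
noncomputable def fiedlerX (m : ℕ) {n : ℕ} (A : ℕ → Matrix (Fin n) (Fin n) ℂ) :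
    SIdx → Matrix (Fin n) (Fin n) ℂ
  | .pos i => if i = m then (A m)⁻¹ else -A i
  | .neg i => if i = 0 then (-A 0)⁻¹ else A i

/-- `M_t^P`, the product of Fiedler matrices of `P` along the index tuple `t`. -/
noncomputable def prodFiedler (m n : ℕ) (A : ℕ → Matrix (Fin n) (Fin n) ℂ) (t : List SIdx) :
    Matrix (Fin m × Fin n) (Fin m × Fin n) ℂ :=
  (t.map fun k => elemMat m n k (fiedlerX m A k)).prod

/-- A nonsingular matrix assignment: the matrices assigned to positions with indices
`±0` or `±m` are nonsingular. -/
def NonsingAssign (m : ℕ) {n : ℕ} (t : List SIdx) (Xs : List (Matrix (Fin n) (Fin n) ℂ)) :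
    Prop :=
  t.length = Xs.length ∧ ∀ p ∈ t.zip Xs, (p.1.val = 0 ∨ p.1.val = m) → IsUnit p.2

/-- The data of an extended generalized Fiedler pencil (EGFP)
`L(λ) = M_{τ₁}(Y₁) M_{σ₁}(X₁) (λ M_τ^P − M_σ^P) M_{σ₂}(X₂) M_{τ₂}(Y₂)`
of the `n × n` matrix polynomial `P(λ) = Σ_{i=0}^m λ^i A_i` of degree `m ≥ 2`. -/
structure EGFPData (m n : ℕ) where
  /-- coefficients of `P` -/
  A : ℕ → Matrix (Fin n) (Fin n) ℂ
  sig : List SIdx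
  tau : List SIdx
  sig1 : List SIdx
  sig2 : List SIdx
  tau1 : List SIdx
  tau2 : List SIdx
  X1 : List (Matrix (Fin n) (Fin n) ℂ)
  X2 : List (Matrix (Fin n) (Fin n) ℂ)
  Y1 : List (Matrix (Fin n) (Fin n) ℂ)
  Y2 : List (Matrix (Fin n) (Fin n) ℂ)
  hm : 2 ≤ m
  hAm : A m ≠ 0
  hsigpos : ∀ k ∈ sig, k.isNeg = false
  htauneg : ∀ k ∈ tau, k.isNeg = true
  /-- `(σ, ω)` is a permutation of `{0, 1, …, m}`, where `τ = −ω`. -/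
  hperm : List.Perm (sig.map SIdx.val ++ tau.map SIdx.val) (List.range (m + 1))
  hsig1 : ∀ k ∈ sig1, k ∈ sig ∧ k.val + 2 ≤ m
  hsig2 : ∀ k ∈ sig2, k ∈ sig ∧ k.val + 2 ≤ m
  htau1 : ∀ k ∈ tau1, k ∈ tau ∧ 2 ≤ k.val
  htau2 : ∀ k ∈ tau2, k ∈ tau ∧ 2 ≤ k.val
  hSIPsig : SIP (sig1 ++ sig ++ sig2)
  hSIPtau : SIP (tau1 ++ tau ++ tau2)
  hX1 : NonsingAssign m sig1 X1
  hX2 : NonsingAssign m sig2 X2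
  hY1 : NonsingAssign m tau1 Y1
  hY2 : NonsingAssign m tau2 Y2
  hA0 : SIdx.neg 0 ∈ tau → IsUnit (A 0)
  hAmUnit : SIdx.pos m ∈ sig → IsUnit (A m)

namespace EGFPData

variable {m n : ℕ}

/-- `M_{τ₁}(Y₁) M_{σ₁}(X₁)`. -/
noncomputable def leftFac (E : EGFPData m n) : Matrix (Fin m × Fin n) (Fin m × Fin n) ℂ :=
  prodAssign m n E.tau1 E.Y1 * prodAssign m n E.sig1 E.X1

/-- `M_{σ₂}(X₂) M_{τ₂}(Y₂)`. -/
noncomputable def rightFac (E : EGFPData m n) : Matrix (Fin m × Fin n) (Fin m × Fin n) ℂ :=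
  prodAssign m n E.sig2 E.X2 * prodAssign m n E.tau2 E.Y2

/-- The coefficient `L₁` of `λ` in `L(λ) = λ L₁ − L₀`. -/
noncomputable def L1 (E : EGFPData m n) : Matrix (Fin m × Fin n) (Fin m × Fin n) ℂ :=
  E.leftFac * prodFiedler m n E.A E.tau * E.rightFac

/-- The constant term `L₀` in `L(λ) = λ L₁ − L₀`. -/
noncomputable def L0 (E : EGFPData m n) : Matrix (Fin m × Fin n) (Fin m × Fin n) ℂ :=
  E.leftFac * prodFiedler m n E.A E.sig * E.rightFac

end EGFPData

/-- The `(i, j)` block (of size `n × n`) of an `mn × mn` matrix. -/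
def blockOf {m n : ℕ} (M : Matrix (Fin m × Fin n) (Fin m × Fin n) ℂ) (i j : Fin m) :
    Matrix (Fin n) (Fin n) ℂ := fun p q => M (i, p) (j, q)

/-- Block penta-diagonal: all blocks `B_{ij}` with `|i − j| > 2` vanish. -/
def BlockPenta {m n : ℕ} (M : Matrix (Fin m × Fin n) (Fin m × Fin n) ℂ) : Prop :=
  ∀ i j : Fin m, ((i : ℕ) + 2 < (j : ℕ) ∨ (j : ℕ) + 2 < (i : ℕ)) → blockOf M i j = 0

/-- Block tridiagonal: all blocks `B_{ij}` with `|i − j| > 1` vanish. -/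
def BlockTri {m n : ℕ} (M : Matrix (Fin m × Fin n) (Fin m × Fin n) ℂ) : Prop :=
  ∀ i j : Fin m, ((i : ℕ) + 1 < (j : ℕ) ∨ (j : ℕ) + 1 < (i : ℕ)) → blockOf M i j = 0

/-- `e_j^T ⊗ I_n` as an `n × mn` matrix, for a 1-indexed block index `j`
(zero when `j` is out of range). -/
def rowSel (m n : ℕ) (j : ℤ) : Matrix (Fin n) (Fin m × Fin n) ℂ :=
  fun p q => if ((q.1 : ℕ) : ℤ) + 1 = j ∧ p = q.2 then 1 else 0

/-- `e_j ⊗ I_n` as an `mn × n` matrix, for a 1-indexed block index `j`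
(zero when `j` is out of range). -/
def colSel (m n : ℕ) (j : ℤ) : Matrix (Fin m × Fin n) (Fin n) ℂ :=
  fun p q => if ((p.1 : ℕ) : ℤ) + 1 = j ∧ p.2 = q then 1 else 0

/-- The matrix polynomial `P(λ) = Σ_{i=0}^m λ^i A_i` as an `n × n` matrix over `ℂ[λ]`. -/
noncomputable def polyP (m n : ℕ) (A : ℕ → Matrix (Fin n) (Fin n) ℂ) :
    Matrix (Fin n) (Fin n) (Polynomial ℂ) := fun p q =>
  ∑ i ∈ Finset.range (m + 1), Polynomial.C (A i p q) * Polynomial.X ^ i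

namespace RowSelAux

/-- Greedy chain length starting at `t`. -/
def gr : List SIdx → SIdx → ℕ
  | [], _ => 0
  | a :: l, t => if a = t then gr l t.succ + 1 else gr l t

/-- No further `t` occurs in the list before `t.succ` has occurred. -/
def H1 (t : SIdx) : List SIdx → Prop
  | [] => True
  | a :: l => a = t.succ ∨ (a ≠ t ∧ H1 t l)

/-- Recursive form of the SIP. -/
def SIPr : List SIdx → Prop
  | [] => True
  | a :: l => H1 a l ∧ SIPr l

theorem chain_iff (α : List SIdx) : ∀ (t : SIdx) (p : ℕ),
    (chainUp t p).Sublist α ↔ p < gr α t := by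
  induction α with
  | nil => intro t p; cases p <;> simp [chainUp, gr]
  | cons a l ih =>
    intro t p
    by_cases h : a = t
    · subst h
      cases p with
      | zero => simp [chainUp, gr]
      | succ p => simp [chainUp, gr, ih]
    · have key : (chainUp t p).Sublist (a :: l) ↔ (chainUp t p).Sublist l := by
        constructor
        · intro hs
          cases p with
          | zero =>
            simp only [chainUp] at hs ⊢
            cases hs with
            | cons _ h' => exact h'
            | cons_cons _ h' => exact absurd rfl h
          | succ p =>
            simp only [chainUp] at hs ⊢
            cases hs with
            | cons _ h' => exact h'
            | cons_cons _ h' => exact absurd rfl h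
        · intro hs; exact hs.cons a
      rw [key, ih]; simp [gr, h]

theorem gr_le (α : List SIdx) : ∀ t, gr α t ≤ α.length := by
  induction α with
  | nil => intro t; simp [gr]
  | cons a l ih =>
    intro t
    simp only [gr, List.length_cons]
    split
    · have := ih t.succ; omega
    · have := ih t; omega

theorem mem_iff (α : List SIdx) (t : SIdx) : t ∈ α ↔ 0 < gr α t := by
  rw [← chain_iff]; simp [chainUp]

theorem consAt_eq (α : List SIdx) (t : SIdx) : consAt α t = (gr α t : ℤ) - 1 := by
  unfold consAt
  have hle := gr_le α t
  split
  · rename_i h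
    rw [mem_iff] at h
    have : @Nat.findGreatest (fun p : ℕ => (chainUp t p).Sublist α)
        (Classical.decPred _) α.length = gr α t - 1 := by
      refine (@Nat.findGreatest_eq_iff _ _ (fun p : ℕ => (chainUp t p).Sublist α)
        (Classical.decPred _)).2 ?_
      refine ⟨by omega, ?_, ?_⟩
      · intro _; rw [chain_iff]; omega
      · intro k hk _; rw [chain_iff]; omega
    rw [this]; omega
  · rename_i h
    rw [mem_iff] at h
    omega

theorem gr_append (α β : List SIdx) : ∀ t,
    gr (α ++ β) t = gr α t + gr β (SIdx.succ^[gr α t] t) := by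
  induction α with
  | nil => intro t; simp [gr]
  | cons a l ih =>
    intro t
    by_cases h : a = t
    · simp [gr, h, ih]; omega
    · simp [gr, h, ih]

theorem gr_last (α : List SIdx) : ∀ t, 0 < gr α t → SIdx.succ^[gr α t - 1] t ∈ α := by
  induction α with
  | nil => intro t; simp [gr]
  | cons a l ih =>
    intro t
    by_cases h : a = t
    · subst h
      intro _
      by_cases h2 : 0 < gr l a.succ
      · have := ih _ h2
        rw [← Function.iterate_succ_apply] at this
        have e : (gr l a.succ - 1).succ = gr (a :: l) a - 1 := by simp [gr]; omega
        rw [e] at this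
        exact List.mem_cons_of_mem _ this
      · have e : gr (a :: l) a - 1 = 0 := by simp [gr]; omega
        rw [e]; simp
    · simp only [gr, h, if_false]
      intro h2
      exact List.mem_cons_of_mem _ (ih _ h2)

theorem H1_of_notMem (t : SIdx) : ∀ l : List SIdx, t ∉ l → H1 t l := by
  intro l
  induction l with
  | nil => intro _; trivial
  | cons a l ih =>
    intro h
    simp only [List.mem_cons, not_or] at h
    exact Or.inr ⟨fun e => h.1 e.symm, ih h.2⟩

theorem H1_append (t : SIdx) (β : List SIdx) : ∀ v : List SIdx, t.succ ∉ v → H1 t (v ++ β) →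
    H1 t β := by
  intro v
  induction v with
  | nil => intro _ h; exact h
  | cons a l ih =>
    intro h h2
    simp only [List.mem_cons, not_or] at h
    rcases h2 with h2 | h2
    · exact absurd h2.symm h.1
    · exact ih h.2 h2.2

theorem H1_mem (t : SIdx) : ∀ l : List SIdx, H1 t l → t ∈ l → t.succ ∈ l := by
  intro l
  induction l with
  | nil => intro _ h; simp at h
  | cons a l ih =>
    intro h h2
    rcases h with h | h
    · simp [h]
    · rcases List.mem_cons.1 h2 with h3 | h3
      · exact absurd h3.symm h.1
      · exact List.mem_cons_of_mem _ (ih h.2 h3)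

theorem SIPr_right (β : List SIdx) : ∀ v : List SIdx, SIPr (v ++ β) → SIPr β := by
  intro v
  induction v with
  | nil => intro h; exact h
  | cons a l ih => intro h; exact ih h.2

theorem SIPr_mem (β : List SIdx) (x : SIdx) : ∀ v : List SIdx, SIPr (v ++ β) → x ∈ v → x ∈ β →
    x.succ ∈ v ++ β := by
  intro v
  induction v with
  | nil => intro _ h; simp at h
  | cons a l ih =>
    intro h h1 h2
    rcases List.mem_cons.1 h1 with h3 | h3
    · subst h3
      exact List.mem_cons_of_mem _ (H1_mem _ _ h.1 (by simp [h2]))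
    · exact List.mem_cons_of_mem _ (ih h.2 h3 h2)

theorem H1_gr (β : List SIdx) : ∀ (α : List SIdx) (t : SIdx), H1 t (α ++ β) → SIPr (α ++ β) →
    H1 (SIdx.succ^[gr α t.succ] t) β := by
  intro α
  induction α with
  | nil => intro t h _; simpa [gr] using h
  | cons a l ih =>
    intro t h hs
    by_cases e : a = t.succ
    · subst e
      simp only [gr, if_true, Function.iterate_succ_apply]
      exact ih _ hs.1 hs.2
    · simp only [gr, e, if_false]
      rcases h with h | h
      · exact absurd h e
      · exact ih _ h.2 hs.2

theorem H1_of_get (x : SIdx) : ∀ r : List SIdx,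
    (∀ b : ℕ, r[b]? = some x → ∃ c < b, r[c]? = some x.succ) → H1 x r := by
  intro r
  induction r with
  | nil => intro _; trivial
  | cons a l ih =>
    intro h
    by_cases e : a = x.succ
    · exact Or.inl e
    · refine Or.inr ⟨?_, ih ?_⟩
      · intro e2
        obtain ⟨c, hc, _⟩ := h 0 (by simp [e2])
        omega
      · intro b hb
        obtain ⟨c, hc, h2⟩ := h (b + 1) (by simpa using hb)
        cases c with
        | zero => simp at h2; exact absurd h2 e
        | succ c => exact ⟨c, by omega, by simpa using h2⟩

theorem SIPr_of_get : ∀ r : List SIdx,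
    (∀ (x : SIdx) (a b : ℕ), a < b → r[a]? = some x → r[b]? = some x →
      ∃ c, a < c ∧ c < b ∧ r[c]? = some x.succ) → SIPr r := by
  intro r
  induction r with
  | nil => intro _; trivial
  | cons y l ih =>
    intro h
    refine ⟨H1_of_get _ _ ?_, ih ?_⟩
    · intro b hb
      obtain ⟨c, h1, h2, h3⟩ := h y 0 (b + 1) (by omega) (by simp) (by simpa using hb)
      cases c with
      | zero => omega
      | succ c => exact ⟨c, by omega, by simpa using h3⟩
    · intro x a b hab ha hb
      obtain ⟨c, h1, h2, h3⟩ := h x (a + 1) (b + 1) (by omega) (by simpa using ha)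
        (by simpa using hb)
      cases c with
      | zero => omega
      | succ c => exact ⟨c, by omega, by omega, by simpa using h3⟩

theorem SIPr_of_SIP (α : List SIdx) (h : SIP α) : SIPr α := by
  apply SIPr_of_get
  intro x a b hab ha hb
  rw [List.getElem?_eq_some_iff] at ha hb
  obtain ⟨ha, ha'⟩ := ha
  obtain ⟨hb, hb'⟩ := hb
  obtain ⟨c, h1, h2, h3⟩ := h ⟨a, ha⟩ ⟨b, hb⟩ hab (by simp [ha', hb'])
  refine ⟨c, h1, h2, ?_⟩
  rw [List.getElem?_eq_some_iff]
  refine ⟨c.2, ?_⟩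
  simpa [ha'] using h3

/-! Matrix part -/

theorem rowSel_mul {m n : ℕ} (r : ℕ) (hr : r < m) (M : Matrix (Fin m × Fin n) (Fin m × Fin n) ℂ) :
    rowSel m n ((r : ℤ) + 1) * M = fun p q => M (⟨r, hr⟩, p) q := by
  ext p q
  rw [Matrix.mul_apply, Finset.sum_eq_single (⟨r, hr⟩, p)]
  · simp [rowSel]
  · rintro ⟨b1, b2⟩ _ hb
    have : ¬ (((b1 : ℕ) : ℤ) + 1 = (r : ℤ) + 1 ∧ p = b2) := by
      rintro ⟨h1, h2⟩
      apply hb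
      have : b1 = ⟨r, hr⟩ := Fin.ext (by simpa using h1)
      rw [this, h2]
    simp only [rowSel, this, if_false, zero_mul]
  · simp

theorem stay {m n : ℕ} (r : ℕ) (hr : r < m) (k : SIdx) (X : Matrix (Fin n) (Fin n) ℂ)
    (h0 : k.val = 0 → r ≠ m - 1) (h1 : k.val = m → r ≠ 0)
    (h2 : k.val ≠ 0 → k.val ≠ m → r ≠ m - k.val - 1 ∧ r ≠ m - k.val) :
    rowSel m n ((r : ℤ) + 1) * elemMat m n k X = rowSel m n ((r : ℤ) + 1) := by
  rw [rowSel_mul r hr]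
  funext p q
  obtain ⟨q1, q2⟩ := q
  have e : ((⟨r, hr⟩ : Fin m) = q1) ↔ (((q1 : ℕ) : ℤ) + 1 = (r : ℤ) + 1) := by
    rw [Fin.ext_iff]; simp; omega
  by_cases c0 : k.val = 0
  · have := h0 c0
    simp only [elemMat, rowSel, c0, if_true, this, if_false, e]
    split_ifs <;> simp_all
  · by_cases c1 : k.val = m
    · have := h1 c1
      simp only [elemMat, rowSel, c0, c1, if_true, this, if_false, e]
      split_ifs <;> simp_all
    · obtain ⟨h3, h4⟩ := h2 c0 c1
      simp only [elemMat, rowSel, c0, c1, h3, h4, if_false, false_and, or_false, Prod.mk.injEq, e]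

theorem step {m n : ℕ} (r r' : ℕ) (hr : r < m) (k : SIdx) (X : Matrix (Fin n) (Fin n) ℂ)
    (h0 : k.val ≠ 0) (h1 : k.val < m)
    (h2 : (k.isNeg = false ∧ r = m - k.val ∧ r' = m - k.val - 1) ∨
      (k.isNeg = true ∧ r = m - k.val - 1 ∧ r' = m - k.val)) :
    rowSel m n ((r : ℤ) + 1) * elemMat m n k X = rowSel m n ((r' : ℤ) + 1) := by
  rw [rowSel_mul r hr]
  funext p q
  obtain ⟨q1, q2⟩ := q
  have e : (((q1 : ℕ) : ℤ) + 1 = (r' : ℤ) + 1) ↔ (q1 : ℕ) = r' := by omega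
  have h1' : k.val ≠ m := by omega
  have n1 : m - k.val ≠ m - k.val - 1 := by omega
  have e2 : ((⟨r, hr⟩ : Fin m) = q1) ↔ ((q1 : ℕ) = r) := by
    rw [Fin.ext_iff]; simp; omega
  simp only [elemMat, rowSel, h0, h1', if_false, e, Prod.mk.injEq, e2]
  rcases h2 with ⟨a, b, c⟩ | ⟨a, b, c⟩
  · simp only [← c]
    simp only [← b, a]
    have : r ≠ r' := by omega
    by_cases z : (q1 : ℕ) = r'
    · simp [z, this]
    · by_cases z2 : (q1 : ℕ) = r <;> simp [z, z2, this]
  · simp only [← b]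
    simp only [← c, a]
    have : r ≠ r' := by omega
    by_cases z : (q1 : ℕ) = r'
    · simp [z, this, this.symm]
    · by_cases z2 : (q1 : ℕ) = r <;> simp [z, z2, this]

theorem prodAssign_nil {m n : ℕ} (Xs : List (Matrix (Fin n) (Fin n) ℂ)) :
    prodAssign m n [] Xs = 1 := by simp [prodAssign]

theorem prodAssign_cons {m n : ℕ} (a : SIdx) (l : List SIdx) (X : Matrix (Fin n) (Fin n) ℂ)
    (Xs : List (Matrix (Fin n) (Fin n) ℂ)) :
    prodAssign m n (a :: l) (X :: Xs) = elemMat m n a X * prodAssign m n l Xs := by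
  simp [prodAssign]

theorem stay_list {m n : ℕ} (r : ℕ) (hr : r < m) : ∀ (l : List SIdx)
    (Xs : List (Matrix (Fin n) (Fin n) ℂ)),
    (∀ k ∈ l, (k.val = 0 → r ≠ m - 1) ∧ (k.val = m → r ≠ 0) ∧
      (k.val ≠ 0 → k.val ≠ m → r ≠ m - k.val - 1 ∧ r ≠ m - k.val)) →
    rowSel m n ((r : ℤ) + 1) * prodAssign m n l Xs = rowSel m n ((r : ℤ) + 1) := by
  intro l
  induction l with
  | nil => intro Xs _; rw [prodAssign_nil, Matrix.mul_one]
  | cons a l ih =>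
    intro Xs h
    cases Xs with
    | nil => simp [prodAssign]
    | cons X Xs =>
      obtain ⟨h0, h1, h2⟩ := h a (by simp)
      rw [prodAssign_cons, ← Matrix.mul_assoc, stay r hr a X h0 h1 h2]
      exact ih Xs fun k hk => h k (by simp [hk])

theorem walk_pos {m n : ℕ} : ∀ (l : List SIdx) (Xs : List (Matrix (Fin n) (Fin n) ℂ)) (s : ℕ),
    l.length = Xs.length → s < m → H1 (.pos s) l → SIPr l →
    (∀ k ∈ l, k.isNeg = false ∧ k.val + 2 ≤ m) →
    rowSel m n ((m : ℤ) - s) * prodAssign m n l Xs =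
      rowSel m n ((m : ℤ) - (s + gr l (.pos (s + 1)))) := by
  intro l
  induction l with
  | nil => intro Xs s _ _ _ _ _; rw [prodAssign_nil, Matrix.mul_one]; simp [gr]
  | cons a l ih =>
    intro Xs s hlen hs hH hS hk
    cases Xs with
    | nil => simp at hlen
    | cons X Xs =>
      have hlen' : l.length = Xs.length := by simpa using hlen
      have hk' : ∀ k ∈ l, k.isNeg = false ∧ k.val + 2 ≤ m := fun k h => hk k (by simp [h])
      obtain ⟨ha, hav⟩ := hk a (by simp)
      have er : ((m : ℤ) - s) = ((m - s - 1 : ℕ) : ℤ) + 1 := by omega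
      rw [prodAssign_cons, ← Matrix.mul_assoc]
      by_cases e : a = SIdx.pos (s + 1)
      · subst e
        have hv : SIdx.val (.pos (s + 1)) = s + 1 := rfl
        rw [hv] at hav
        rw [er, step (m - s - 1) (m - s - 2) (by omega) (.pos (s + 1)) X (by rw [hv]; omega)
          (by rw [hv]; omega) (Or.inl ⟨rfl, by rw [hv]; omega, by rw [hv]; omega⟩)]
        have er2 : (((m - s - 2 : ℕ) : ℤ) + 1) = (m : ℤ) - ((s + 1 : ℕ) : ℤ) := by omega
        rw [er2, ih Xs (s + 1) hlen' (by omega) hS.1 hS.2 hk']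
        congr 1
        simp [gr, SIdx.succ]; ring
      · rcases hH with hH | ⟨hne, hH⟩
        · exact absurd hH e
        · have : gr (a :: l) (.pos (s + 1)) = gr l (.pos (s + 1)) := by simp [gr, e]
          rw [this, ← ih Xs s hlen' hs hH hS.2 hk', er]
          congr 1
          cases a with
          | neg j => simp [SIdx.isNeg] at ha
          | pos j =>
            simp only [SIdx.val] at hav
            have h1 : j ≠ s + 1 := fun h => e (by rw [h])
            have h2 : j ≠ s := fun h => hne (by rw [h])
            apply stay _ (by omega) <;> simp only [SIdx.val] <;> omega

theorem walk_neg {m n : ℕ} : ∀ (l : List SIdx) (Xs : List (Matrix (Fin n) (Fin n) ℂ)) (s : ℕ),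
    l.length = Xs.length → s < m → H1 (.neg (s + 1)) l → SIPr l →
    (∀ k ∈ l, k.isNeg = true ∧ 2 ≤ k.val ∧ k.val ≤ m) →
    rowSel m n ((m : ℤ) - s) * prodAssign m n l Xs =
      rowSel m n ((m : ℤ) - s + gr l (.neg s)) := by
  intro l
  induction l with
  | nil => intro Xs s _ _ _ _ _; rw [prodAssign_nil, Matrix.mul_one]; simp [gr]
  | cons a l ih =>
    intro Xs s hlen hs hH hS hk
    cases Xs with
    | nil => simp at hlen
    | cons X Xs =>
      have hlen' : l.length = Xs.length := by simpa using hlen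
      have hk' : ∀ k ∈ l, k.isNeg = true ∧ 2 ≤ k.val ∧ k.val ≤ m := fun k h => hk k (by simp [h])
      obtain ⟨ha, hav, ham⟩ := hk a (by simp)
      have er : ((m : ℤ) - s) = ((m - s - 1 : ℕ) : ℤ) + 1 := by omega
      rw [prodAssign_cons, ← Matrix.mul_assoc]
      by_cases e : a = SIdx.neg s
      · subst e
        have hv : SIdx.val (.neg s) = s := rfl
        rw [hv] at hav
        obtain ⟨s, rfl⟩ : ∃ s', s = s' + 1 := ⟨s - 1, by omega⟩
        rw [er, step (m - (s + 1) - 1) (m - s - 1) (by omega) (.neg (s + 1)) X (by rw [hv]; omega)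
          (by rw [hv]; omega) (Or.inr ⟨rfl, by rw [hv], by rw [hv]; omega⟩)]
        have er2 : (((m - s - 1 : ℕ) : ℤ) + 1) = (m : ℤ) - (s : ℤ) := by omega
        rw [er2, ih Xs s hlen' (by omega) hS.1 hS.2 hk', ← er]
        congr 1
        simp [gr, SIdx.succ]; ring
      · rcases hH with hH | ⟨hne, hH⟩
        · exact absurd hH e
        · have : gr (a :: l) (.neg s) = gr l (.neg s) := by simp [gr, e]
          rw [this, ← ih Xs s hlen' hs hH hS.2 hk', er]
          congr 1
          cases a with
          | pos j => simp [SIdx.isNeg] at ha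
          | neg j =>
            simp only [SIdx.val] at hav ham
            have h1 : j ≠ s + 1 := fun h => hne (by rw [h])
            have h2 : j ≠ s := fun h => e (by rw [h])
            apply stay _ (by omega) <;> simp only [SIdx.val] <;> omega

theorem iter_pos (g s : ℕ) : SIdx.succ^[g] (.pos s) = .pos (s + g) := by
  induction g generalizing s with
  | zero => rfl
  | succ g ih => rw [Function.iterate_succ_apply, SIdx.succ, ih]; congr 1; omega

theorem chainUp_succ_right : ∀ (p : ℕ) (t : SIdx),
    chainUp t (p + 1) = chainUp t p ++ [SIdx.succ^[p + 1] t] := by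
  intro p
  induction p with
  | zero => intro t; rfl
  | succ p ih =>
    intro t
    rw [chainUp, ih]
    rfl

theorem mem_chainUp : ∀ (p s j : ℕ), j ≤ p → SIdx.pos (s + j) ∈ chainUp (.pos s) p := by
  intro p
  induction p with
  | zero => intro s j h; obtain rfl : j = 0 := by omega
            simp [chainUp]
  | succ p ih =>
    intro s j h
    rw [chainUp]
    cases j with
    | zero => simp
    | succ j =>
      have := ih (s + 1) j (by omega)
      rw [show s + 1 + j = s + (j + 1) by omega] at this
      exact List.mem_cons_of_mem _ this

theorem chainUp_length : ∀ (p : ℕ) (t : SIdx), (chainUp t p).length = p + 1 := by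
  intro p
  induction p with
  | zero => intro t; rfl
  | succ p ih => intro t; simp [chainUp, ih]

theorem sublist_skip (h : SIdx) (c v : List SIdx) : ∀ u : List SIdx, h ∉ u →
    (h :: c).Sublist (u ++ v) → (h :: c).Sublist v := by
  intro u
  induction u with
  | nil => intro _ h; exact h
  | cons a l ih =>
    intro hn hs
    simp only [List.mem_cons, not_or] at hn
    cases hs with
    | cons _ h' => exact ih hn.2 h'
    | cons_cons _ h' => exact absurd rfl hn.1

theorem invsAt_spec (α : List SIdx) (h : SIdx.pos 0 ∈ α) : ∃ q : ℕ,
    invsAt α (.pos 0) = (q : ℤ) ∧ ((chainUp (.pos 0) q).reverse).Sublist α ∧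
    ¬ ((chainUp (.pos 0) (q + 1)).reverse).Sublist α := by
  unfold invsAt
  simp only [h, if_true]
  refine ⟨_, rfl, ?_, ?_⟩
  · exact @Nat.findGreatest_spec 0 (fun p : ℕ => ((chainUp (.pos 0) p).reverse).Sublist α)
      (Classical.decPred _) α.length (by omega) (by simpa [chainUp] using h)
  · intro hs
    have hl := hs.length_le
    rw [List.length_reverse, chainUp_length] at hl
    exact @Nat.findGreatest_is_greatest _ (fun p : ℕ => ((chainUp (.pos 0) p).reverse).Sublist α)
      (Classical.decPred _) α.length (Nat.lt_succ_self _) (by omega) hs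

end RowSelAux

open RowSelAux

/-- **Lemma on row selection, `0 ∈ ω`, where `ω = −τ`.**
With `i₀ := i₀(ω)` and `R := M_{σ₂}(X₂) M_{τ₂}(Y₂)`:
(a) if `i₀+1 ∈ σ` and `s := i₀ + c_{i₀+1}(σ) + 1 < m` then
`(e^T_{m−s} ⊗ I_n) R = e^T_{m−p} ⊗ I_n` with `p = i₀ + c_{i₀+1}(σ,σ₂) + 1`;
(b) if `i₀+1 ∈ σ` and `s = m` then `(e^T_1 ⊗ I_n) R = e^T_p ⊗ I_n` with
`p = c_{−(m−1)}(τ₂) + 2`;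
(c) if `i₀ < m` and `i₀+1 ∉ σ` then `(e^T_{m−i₀} ⊗ I_n) R = e^T_{m−p} ⊗ I_n` with
`p = i₀ − c_{−i₀}(τ₂) − 1`;
(d) if `i₀ = m` then `(e^T_m ⊗ I_n) R = e^T_m ⊗ I_n`. -/
theorem egfp_row_selection_omega {m n : ℕ} (E : EGFPData m n)
    (h0 : SIdx.neg 0 ∈ E.tau) :
    let ω := E.tau.map SIdx.negate
    let R := prodAssign m n E.sig2 E.X2 * prodAssign m n E.tau2 E.Y2
    let i0 := invsAt ω (.pos 0)
    (SIdx.pos (i0.toNat + 1) ∈ E.sig →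
      i0 + consAt E.sig (.pos (i0.toNat + 1)) + 1 < (m : ℤ) →
      rowSel m n ((m : ℤ) - (i0 + consAt E.sig (.pos (i0.toNat + 1)) + 1)) * R =
        rowSel m n ((m : ℤ) - (i0 + consAt (E.sig ++ E.sig2) (.pos (i0.toNat + 1)) + 1))) ∧
    (SIdx.pos (i0.toNat + 1) ∈ E.sig →
      i0 + consAt E.sig (.pos (i0.toNat + 1)) + 1 = (m : ℤ) →
      rowSel m n 1 * R = rowSel m n (consAt E.tau2 (.neg (m - 1)) + 2)) ∧
    (i0 < (m : ℤ) → SIdx.pos (i0.toNat + 1) ∉ E.sig →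
      rowSel m n ((m : ℤ) - i0) * R =
        rowSel m n ((m : ℤ) - (i0 - consAt E.tau2 (.neg i0.toNat) - 1))) ∧
    (i0 = (m : ℤ) → rowSel m n (m : ℤ) * R = rowSel m n (m : ℤ)) := by
  classical
  intro ω R i0
  have hm := E.hm
  have hnd : (E.sig.map SIdx.val ++ E.tau.map SIdx.val).Nodup :=
    E.hperm.nodup_iff.2 List.nodup_range
  have hdisj : ∀ j, SIdx.pos j ∈ E.sig → SIdx.neg j ∈ E.tau → False := by
    intro j h1 h2
    rw [List.nodup_append] at hnd
    exact hnd.2.2 j (List.mem_map.2 ⟨_, h1, rfl⟩) j (List.mem_map.2 ⟨_, h2, rfl⟩) rfl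
  have hsv : ∀ k ∈ E.sig, k.val ≤ m := by
    intro k hk
    have := E.hperm.subset (List.mem_append_left _ (List.mem_map.2 ⟨k, hk, rfl⟩))
    rw [List.mem_range] at this; omega
  have htv : ∀ k ∈ E.tau, k.val ≤ m := by
    intro k hk
    have := E.hperm.subset (List.mem_append_right _ (List.mem_map.2 ⟨k, hk, rfl⟩))
    rw [List.mem_range] at this; omega
  have hcov : ∀ j, j ≤ m → SIdx.pos j ∉ E.sig → SIdx.neg j ∈ E.tau := by
    intro j hj hn
    have : j ∈ E.sig.map SIdx.val ++ E.tau.map SIdx.val :=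
      E.hperm.symm.subset (List.mem_range.2 (by omega))
    rcases List.mem_append.1 this with h | h
    · obtain ⟨k, hk, hkj⟩ := List.mem_map.1 h
      have := E.hsigpos k hk
      cases k with
      | pos i => simp only [SIdx.val] at hkj; subst hkj; exact absurd hk hn
      | neg i => simp [SIdx.isNeg] at this
    · obtain ⟨k, hk, hkj⟩ := List.mem_map.1 h
      have := E.htauneg k hk
      cases k with
      | neg i => simp only [SIdx.val] at hkj; subst hkj; exact hk
      | pos i => simp [SIdx.isNeg] at this
  have hωmem : ∀ j, SIdx.pos j ∈ ω → SIdx.neg j ∈ E.tau := by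
    intro j hj
    obtain ⟨k, hk, hkj⟩ := List.mem_map.1 hj
    cases k with
    | pos i => simp [SIdx.negate] at hkj
    | neg i => simp only [SIdx.negate, SIdx.pos.injEq] at hkj; subst hkj; exact hk
  have hS2 : ∀ k ∈ E.sig2, k.isNeg = false ∧ k.val + 2 ≤ m := fun k hk =>
    ⟨E.hsigpos k (E.hsig2 k hk).1, (E.hsig2 k hk).2⟩
  have hT2 : ∀ k ∈ E.tau2, k.isNeg = true ∧ 2 ≤ k.val ∧ k.val ≤ m := fun k hk =>
    ⟨E.htauneg k (E.htau2 k hk).1, (E.htau2 k hk).2, htv k (E.htau2 k hk).1⟩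
  have hSs : SIPr (E.sig ++ E.sig2) := by
    have := SIPr_of_SIP _ E.hSIPsig
    rw [List.append_assoc] at this
    exact SIPr_right _ _ this
  have hSt : SIPr (E.tau ++ E.tau2) := by
    have := SIPr_of_SIP _ E.hSIPtau
    rw [List.append_assoc] at this
    exact SIPr_right _ _ this
  have hω0 : SIdx.pos 0 ∈ ω := List.mem_map.2 ⟨_, h0, rfl⟩
  obtain ⟨q, hq, hsub, hnsub⟩ := invsAt_spec ω hω0
  have hi0 : i0 = (q : ℤ) := hq
  clear_value i0
  subst hi0
  have hqall : ∀ j, j ≤ q → SIdx.neg j ∈ E.tau := by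
    intro j hj
    apply hωmem
    apply hsub.subset
    rw [List.mem_reverse]
    simpa using mem_chainUp q 0 j hj
  have hqs : SIdx.pos q ∉ E.sig := fun h => hdisj q h (hqall q le_rfl)
  have hqs2 : ∀ j, SIdx.pos j ∉ E.sig → SIdx.pos j ∉ E.sig2 := fun j h h' =>
    h (E.hsig2 _ h').1
  simp only [Int.toNat_natCast, consAt_eq]
  refine ⟨?_, ?_, ?_, ?_⟩
  · intro hmem hlt
    set g := gr E.sig (.pos (q + 1)) with hg
    have hgpos : 0 < g := (mem_iff _ _).1 hmem
    have hH : H1 (.pos (q + g)) E.sig2 := by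
      have := H1_gr E.sig2 E.sig (.pos q) (H1_of_notMem _ _ (by
        simp [hqs, hqs2 q hqs])) hSs
      rw [iter_pos] at this
      exact this
    have hgapp : gr (E.sig ++ E.sig2) (.pos (q + 1)) =
        g + gr E.sig2 (.pos (q + g + 1)) := by
      rw [gr_append, iter_pos, ← hg]
      congr 3; omega
    rw [hgapp]
    set g2 := gr E.sig2 (.pos (q + g + 1)) with hg2
    have hp : SIdx.pos (q + g + g2) ∈ E.sig := by
      have := gr_last (E.sig ++ E.sig2) (.pos (q + 1)) (by omega)
      rw [iter_pos, hgapp, show q + 1 + (g + g2 - 1) = q + g + g2 by omega] at this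
      rcases List.mem_append.1 this with h | h
      · exact h
      · exact (E.hsig2 _ h).1
    have hpm : q + g + g2 < m := by
      by_cases hz : g2 = 0
      · omega
      · have := gr_last E.sig2 (.pos (q + g + 1)) (by omega)
        rw [iter_pos, ← hg2, show q + g + 1 + (g2 - 1) = q + g + g2 by omega] at this
        have := (hS2 _ this).2
        simp only [SIdx.val] at this
        omega
    have e1 : (m : ℤ) - (q + ((g : ℤ) - 1) + 1) = (m : ℤ) - ((q + g : ℕ) : ℤ) := by
      push_cast; ring
    rw [e1, ← Matrix.mul_assoc,
      walk_pos E.sig2 E.X2 (q + g) E.hX2.1 (by omega) hH (SIPr_right _ _ hSs) hS2, ← hg2]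
    have e2 : (m : ℤ) - (((q + g : ℕ) : ℤ) + (g2 : ℤ)) = ((m - (q + g + g2) - 1 : ℕ) : ℤ) + 1 := by
      omega
    have e3 : (m : ℤ) - ((q : ℤ) + (((g + g2 : ℕ) : ℤ) - 1) + 1) =
        ((m - (q + g + g2) - 1 : ℕ) : ℤ) + 1 := by
      omega
    rw [e2, e3]
    apply stay_list _ (by omega)
    intro k hk
    obtain ⟨k1, k2, k3⟩ := hT2 k hk
    cases k with
    | pos j => simp [SIdx.isNeg] at k1
    | neg j =>
      have j1 : j ≠ q + g + g2 := by
        rintro rfl; exact hdisj _ hp (E.htau2 _ hk).1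
      have j2 : j ≠ q + g + g2 + 1 := by
        rintro rfl
        have := SIPr_mem _ _ _ hSt (E.htau2 _ hk).1 hk
        rcases List.mem_append.1 this with h | h
        · exact hdisj _ hp h
        · exact hdisj _ hp (E.htau2 _ h).1
      simp only [SIdx.val] at k2 k3 ⊢
      omega
  · intro hmem heq
    set g := gr E.sig (.pos (q + 1)) with hg
    have hgpos : 0 < g := (mem_iff _ _).1 hmem
    have hms : SIdx.pos m ∈ E.sig := by
      have := gr_last E.sig (.pos (q + 1)) (by omega)
      rw [iter_pos, ← hg, show q + 1 + (g - 1) = m by omega] at this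
      exact this
    have e0 : (1 : ℤ) = ((0 : ℕ) : ℤ) + 1 := by simp
    have hst : rowSel m n 1 * prodAssign m n E.sig2 E.X2 = rowSel m n 1 := by
      rw [e0]
      apply stay_list _ (by omega)
      intro k hk
      have := (hS2 k hk).2
      omega
    have e1 : (1 : ℤ) = (m : ℤ) - ((m - 1 : ℕ) : ℤ) := by omega
    rw [← Matrix.mul_assoc, hst]
    have hw := walk_neg (m := m) (n := n) E.tau2 E.Y2 (m - 1) E.hY2.1 (by omega)
      (H1_of_notMem _ _ (fun h => hdisj m hms (by
        rw [show m - 1 + 1 = m by omega] at h; exact (E.htau2 _ h).1))) (SIPr_right _ _ hSt) hT2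
    rw [← e1] at hw
    rw [hw]
    congr 1; ring
  · intro hlt hn
    have hqm : q < m := by exact_mod_cast hlt
    have e1 : (m : ℤ) - q = ((m - q - 1 : ℕ) : ℤ) + 1 := by omega
    have hst : rowSel m n ((m : ℤ) - q) * prodAssign m n E.sig2 E.X2 =
        rowSel m n ((m : ℤ) - q) := by
      rw [e1]
      apply stay_list _ (by omega)
      intro k hk
      obtain ⟨k1, k2⟩ := hS2 k hk
      cases k with
      | neg j => simp [SIdx.isNeg] at k1
      | pos j =>
        have j1 : j ≠ q := by rintro rfl; exact hqs2 _ hqs hk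
        have j2 : j ≠ q + 1 := by rintro rfl; exact hqs2 _ hn hk
        simp only [SIdx.val] at k2 ⊢
        omega
    have hH : H1 (.neg (q + 1)) E.tau2 := by
      have hmem := hcov (q + 1) (by omega) hn
      obtain ⟨u, v, huv⟩ := List.append_of_mem hmem
      have hS' := hSt
      rw [huv, List.append_assoc] at hS'
      have hH' := (SIPr_right _ _ hS').1
      refine H1_append _ _ v ?_ hH'
      intro hv
      change SIdx.neg q ∈ v at hv
      apply hnsub
      have htn : E.tau.Nodup := (List.nodup_append.1 hnd).2.1.of_map
      rw [huv] at htn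
      have hqu : SIdx.neg q ∉ u ++ [SIdx.neg (q + 1)] := by
        intro h
        rw [show u ++ SIdx.neg (q + 1) :: v = (u ++ [SIdx.neg (q + 1)]) ++ v by simp] at htn
        exact (List.nodup_append.1 htn).2.2 _ h _ hv rfl
      have hωe : ω = (u ++ [SIdx.neg (q + 1)]).map SIdx.negate ++ v.map SIdx.negate := by
        change E.tau.map SIdx.negate = _
        rw [huv]; simp
      have hqu' : SIdx.pos q ∉ (u ++ [SIdx.neg (q + 1)]).map SIdx.negate := by
        intro h
        obtain ⟨k, hk, hkj⟩ := List.mem_map.1 h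
        cases k with
        | pos i => simp [SIdx.negate] at hkj
        | neg i => simp only [SIdx.negate, SIdx.pos.injEq] at hkj; subst hkj; exact hqu hk
      have hch : ∃ c, (chainUp (.pos 0) q).reverse = SIdx.pos q :: c := by
        cases q with
        | zero => exact ⟨[], rfl⟩
        | succ q =>
          rw [chainUp_succ_right, iter_pos]
          exact ⟨(chainUp (.pos 0) q).reverse, by simp⟩
      obtain ⟨c, hc⟩ := hch
      have hs' := hsub
      rw [hc, hωe] at hs'
      have hs'' := sublist_skip _ _ _ _ hqu' hs'
      rw [chainUp_succ_right, iter_pos, List.reverse_append, hc, hωe]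
      have : ((u ++ [SIdx.neg (q + 1)]).map SIdx.negate ++ v.map SIdx.negate) =
          u.map SIdx.negate ++ (SIdx.pos (0 + (q + 1)) :: v.map SIdx.negate) := by
        simp [SIdx.negate]
      rw [this]
      exact (hs''.cons_cons _).trans (List.sublist_append_right _ _)
    rw [← Matrix.mul_assoc, hst,
      walk_neg E.tau2 E.Y2 q E.hY2.1 hqm hH (SIPr_right _ _ hSt) hT2]
    congr 1; ring
  · intro heq
    have hqm : q = m := by exact_mod_cast heq
    have e1 : (m : ℤ) = ((m - 1 : ℕ) : ℤ) + 1 := by omega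
    rw [← Matrix.mul_assoc, e1, stay_list _ (by omega), stay_list _ (by omega)]
    · intro k hk
      obtain ⟨k1, k2, k3⟩ := hT2 k hk
      omega
    · intro k hk
      obtain ⟨k1, k2⟩ := hS2 k hk
      cases k with
      | neg j => simp [SIdx.isNeg] at k1
      | pos j =>
        exact absurd (hqall j (by simp only [SIdx.val] at k2; omega))
          (hdisj j (E.hsig2 _ hk).1)
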